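/- In ℂ[X_{13}, X_{14}, X_{24}, X_{25}, X_{35}], the following Rayleigh-difference identity holds: (∂Adj_2/∂X_{13})·(∂Adj_2/∂X_{14}) − Adj_2·(∂²Adj_2/∂X_{13}∂X_{14}) = −X_{24}·X_{25}·X_{35}·(X_{24} − X_{25} + X_{35}). -/

import Mathlib

open MvPolynomial

/- Variables `X_{13}, X_{14}, X_{24}, X_{25}, X_{35}` of
`ℂ[X_{13}, X_{14}, X_{24}, X_{25}, X_{35}]`, indexed by `Fin 5` in this order. -/
noncomputable def X13 : MvPolynomial (Fin 5) ℂ := X 0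
noncomputable def X14 : MvPolynomial (Fin 5) ℂ := X 1
noncomputable def X24 : MvPolynomial (Fin 5) ℂ := X 2
noncomputable def X25 : MvPolynomial (Fin 5) ℂ := X 3
noncomputable def X35 : MvPolynomial (Fin 5) ℂ := X 4

/-- The universal adjoint of the 2-dimensional ABHY associahedron. -/
noncomputable def Adj2 : MvPolynomial (Fin 5) ℂ :=
  X13*X14*X24 + X14*X24*X25 + X13*X14*X35 + X13*X25*X35 + X24*X25*X35

/- `X13` is the variable with index `0` and `X14` the variable with index `1`. -/
theorem stmt_18 :
    pderiv 0 Adj2 * pderiv 1 Adj2 - Adj2 * pderiv 0 (pderiv 1 Adj2) =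
      -(X24 * X25 * X35 * (X24 - X25 + X35)) := by
  have h₀ : pderiv 0 Adj2 = X14 * (X24 + X35) + X25 * X35 := by
    simp [Adj2, X13, X14, X24, X25, X35, pderiv_X]
    ring
  have h₁ : pderiv 1 Adj2 = X13 * (X24 + X35) + X24 * X25 := by
    simp [Adj2, X13, X14, X24, X25, X35, pderiv_X]
    ring
  have h₀₁ : pderiv 0 (pderiv 1 Adj2) = X24 + X35 := by
    rw [h₁]
    simp [X13, X24, X25, X35, pderiv_X]
  rw [h₀₁, h₀, h₁, Adj2]
  ring
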